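/- For every agent j with b*_j < b_j, exactly one of the following two properties holds: (1) there is an agent i and an SB-balancing path from i to j in the transformation graph G_{O*→O}; (2) there is an agent i with b*_i > b_i and a BB-balancing path from i to j in G_{O*→O}. -/

import Mathlib

open Finset

variable {N G : Type*}

/-- Agent `i`'s 2-value additive valuation of bundle `A`. -/
def twoVal [DecidableEq G] (Bset : N → Finset G) (v : ℚ) (i : N) (A : Finset G) : ℚ :=
  ((A ∩ Bset i).card : ℚ) + v * ((A \ Bset i).card : ℚ)

/-- The Nash product of an allocation. -/
def nashProd [Fintype N] [DecidableEq G] (Bset : N → Finset G) (v : ℚ)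
    (A : N → Finset G) : ℚ :=
  ∏ i, twoVal Bset v i (A i)

/-- An allocation: pairwise disjoint bundles covering all of `G`. -/
def IsAllocation [Fintype N] [Fintype G] [DecidableEq G] (A : N → Finset G) : Prop :=
  (Set.univ : Set N).PairwiseDisjoint A ∧ Finset.univ.biUnion A = (Finset.univ : Finset G)

/-- A non-wasteful allocation. -/
def IsNonWasteful [Fintype N] [DecidableEq G] (Bset A : N → Finset G) : Prop :=
  (Set.univ : Set N).PairwiseDisjoint A ∧ (∀ i, A i ⊆ Bset i) ∧
    Finset.univ.biUnion A = Finset.univ.biUnion Bset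

/-- `O` is an optimal allocation for the dichotomous instance: among non-wasteful
allocations it maximizes the number of agents with nonempty bundle and, subject to
that, the product of bundle sizes over agents with nonempty bundle. -/
def DichOptimal [Fintype N] [DecidableEq G] (Bset O : N → Finset G) : Prop :=
  IsNonWasteful Bset O ∧
    ∀ O' : N → Finset G, IsNonWasteful Bset O' →
      ((Finset.univ.filter fun i => O' i ≠ ∅).card ≤
        (Finset.univ.filter fun i => O i ≠ ∅).card) ∧
      ((Finset.univ.filter fun i => O' i ≠ ∅).card =
          (Finset.univ.filter fun i => O i ≠ ∅).card →
        ∏ i ∈ Finset.univ.filter fun i => O' i ≠ ∅, (O' i).card ≤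
          ∏ i ∈ Finset.univ.filter fun i => O i ≠ ∅, (O i).card)

/-- `Ostar` maximizes the Nash product over all allocations and, among Nash-product
maximizers, maximizes `∑ i, |O i ∩ Ostar i|` (it is sum-closest to `O`). -/
def NashOptimalClosest [Fintype N] [Fintype G] [DecidableEq G]
    (Bset : N → Finset G) (v : ℚ) (O Ostar : N → Finset G) : Prop :=
  IsAllocation Ostar ∧
    (∀ A : N → Finset G, IsAllocation A → nashProd Bset v A ≤ nashProd Bset v Ostar) ∧
    (∀ A : N → Finset G, IsAllocation A → nashProd Bset v A = nashProd Bset v Ostar →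
      ∑ i, (O i ∩ A i).card ≤ ∑ i, (O i ∩ Ostar i).card)

/-- There is a BB-balancing path from `i` to `j` in the transformation graph `G_{Aa → Ab}`. -/
def ExistsBBPath [DecidableEq G] (Aa Ab Bset : N → Finset G) (i j : N) : Prop :=
  ∃ (k : ℕ) (hk : 1 ≤ k) (ag : Fin (k + 1) → N) (gd : Fin k → G),
    Function.Injective gd ∧ ag 0 = i ∧ ag (Fin.last k) = j ∧
    (∀ t : Fin k, gd t ∈ Aa (ag t.castSucc) ∧ gd t ∈ Ab (ag t.succ)) ∧
    (∀ t : Fin k, 1 ≤ t.val →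
      (gd t ∈ Bset (ag t.castSucc) ↔
        gd ⟨t.val - 1, by have := t.isLt; omega⟩ ∈ Bset (ag t.castSucc))) ∧
    gd ⟨0, by omega⟩ ∈ Bset i ∧ gd ⟨k - 1, by omega⟩ ∈ Bset j

/-- There is an SB-balancing path from `i` to `j` in the transformation graph `G_{Aa → Ab}`. -/
def ExistsSBPath [DecidableEq G] (Aa Ab Bset : N → Finset G) (i j : N) : Prop :=
  ∃ (k : ℕ) (hk : 1 ≤ k) (ag : Fin (k + 1) → N) (gd : Fin k → G),
    Function.Injective gd ∧ ag 0 = i ∧ ag (Fin.last k) = j ∧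
    (∀ t : Fin k, gd t ∈ Aa (ag t.castSucc) ∧ gd t ∈ Ab (ag t.succ)) ∧
    (∀ t : Fin k, 1 ≤ t.val →
      (gd t ∈ Bset (ag t.castSucc) ↔
        gd ⟨t.val - 1, by have := t.isLt; omega⟩ ∈ Bset (ag t.castSucc))) ∧
    gd ⟨0, by omega⟩ ∉ Bset i ∧ gd ⟨k - 1, by omega⟩ ∈ Bset j

/-- The family obtained from `Aa` by handing the goods of `P` to their owners in `Ab`. -/
def reroute [DecidableEq G] (Aa Ab : N → Finset G) (P : Finset G) (a : N) : Finset G :=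
  (Aa a \ P) ∪ (P ∩ Ab a)

/-- Rerouting the goods of `P` from `Aa` to `Ab` costs `i` one good and gives `j` one good; all
goods of `P`, except possibly `g₀ ∈ Aa i`, are big for their owner in `Aa`. -/
structure IsUnitFlow [DecidableEq N] [DecidableEq G] (Aa Ab Bset : N → Finset G) (i j : N) (P : Finset G)
    (g₀ : G) : Prop where
  mem_source : g₀ ∈ P ∧ g₀ ∈ Aa i
  mem_target : ∀ g ∈ P, ∃ a, g ∈ Ab a
  big : ∀ a, ∀ g ∈ P, g ∈ Aa a → g ≠ g₀ → g ∈ Bset a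
  card_eq : ∀ a, (P ∩ Aa a).card + (if j = a then 1 else 0) =
    (P ∩ Ab a).card + (if i = a then 1 else 0)

section Valuation

variable [DecidableEq G] {Bset : N → Finset G} {v : ℚ} {a : N} {C D : Finset G}

lemma twoVal_union (h : Disjoint C D) :
    twoVal Bset v a (C ∪ D) = twoVal Bset v a C + twoVal Bset v a D := by
  unfold twoVal
  rw [union_inter_distrib_right, union_sdiff_distrib,
    card_union_of_disjoint (h.mono inter_subset_left inter_subset_left),
    card_union_of_disjoint (h.mono sdiff_subset sdiff_subset)]
  push_cast
  ring

lemma twoVal_of_subset (h : C ⊆ Bset a) : twoVal Bset v a C = C.card := by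
  unfold twoVal
  rw [inter_eq_left.2 h, sdiff_eq_empty_iff_subset.2 h]
  simp

lemma twoVal_singleton_of_notMem {g : G} (h : g ∉ Bset a) : twoVal Bset v a {g} = v := by
  simp [twoVal, h, sdiff_eq_self_of_disjoint]

lemma le_twoVal_singleton (hv1 : v < 1) (g : G) : v ≤ twoVal Bset v a {g} := by
  by_cases h : g ∈ Bset a
  · rw [twoVal_of_subset (by simpa using h)]
    simpa using hv1.le
  · rw [twoVal_singleton_of_notMem h]

lemma twoVal_nonneg (hv0 : 0 < v) : 0 ≤ twoVal Bset v a C := by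
  unfold twoVal
  positivity

lemma twoVal_reroute {Aa Ab : N → Finset G} (P : Finset G) :
    twoVal Bset v a (reroute Aa Ab P a) + twoVal Bset v a (P ∩ Aa a) =
      twoVal Bset v a (Aa a) + twoVal Bset v a (P ∩ Ab a) := by
  have h1 : Disjoint (Aa a \ P) (P ∩ Ab a) := disjoint_sdiff.symm.mono_right inter_subset_left
  have h2 : Disjoint (Aa a \ P) (P ∩ Aa a) := disjoint_sdiff.symm.mono_right inter_subset_left
  have h3 : Aa a = (Aa a \ P) ∪ (P ∩ Aa a) := by grind
  conv_rhs => rw [h3, twoVal_union h2]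
  rw [reroute, twoVal_union h1]
  ring

lemma card_reroute {Aa Ab : N → Finset G} (P : Finset G) :
    (reroute Aa Ab P a).card + (P ∩ Aa a).card = (Aa a).card + (P ∩ Ab a).card := by
  have h1 : Disjoint (Aa a \ P) (P ∩ Ab a) := disjoint_sdiff.symm.mono_right inter_subset_left
  rw [reroute, card_union_of_disjoint h1, inter_comm P (Aa a)]
  have := card_sdiff_add_card_inter (Aa a) P
  omega

end Valuation

section Families

lemma eq_of_mem_of_pairwiseDisjoint {A : N → Finset G}
    (hA : (Set.univ : Set N).PairwiseDisjoint A) {a b : N} {g : G}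
    (ha : g ∈ A a) (hb : g ∈ A b) : a = b := by
  by_contra hab
  exact disjoint_left.1 (hA (Set.mem_univ a) (Set.mem_univ b) hab) ha hb

lemma pairwiseDisjoint_of_eq {A : N → Finset G}
    (h : ∀ a b g, g ∈ A a → g ∈ A b → a = b) : (Set.univ : Set N).PairwiseDisjoint A := by
  intro a _ b _ hab
  exact disjoint_left.2 fun g ha hb => hab (h a b g ha hb)

variable [DecidableEq G]

lemma pairwiseDisjoint_reroute {Aa Ab : N → Finset G}
    (ha : (Set.univ : Set N).PairwiseDisjoint Aa) (hb : (Set.univ : Set N).PairwiseDisjoint Ab)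
    (P : Finset G) : (Set.univ : Set N).PairwiseDisjoint (reroute Aa Ab P) := by
  refine pairwiseDisjoint_of_eq fun a b g h1 h2 => ?_
  simp only [reroute, mem_union, mem_sdiff, mem_inter] at h1 h2
  rcases h1 with h1 | h1 <;> rcases h2 with h2 | h2
  · exact eq_of_mem_of_pairwiseDisjoint ha h1.1 h2.1
  · exact absurd h2.1 h1.2
  · exact absurd h1.1 h2.2
  · exact eq_of_mem_of_pairwiseDisjoint hb h1.2 h2.2

variable [Fintype N]

lemma IsNonWasteful.exists_mem {Bset O : N → Finset G} (hO : IsNonWasteful Bset O) {a : N} {g : G}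
    (hg : g ∈ Bset a) : ∃ b, g ∈ O b := by
  have : g ∈ univ.biUnion O := hO.2.2 ▸ mem_biUnion.2 ⟨a, mem_univ a, hg⟩
  simpa using this

variable [Fintype G]

lemma IsAllocation.exists_mem {A : N → Finset G} (hA : IsAllocation A) (g : G) :
    ∃ a, g ∈ A a := by
  have : g ∈ univ.biUnion A := hA.2 ▸ mem_univ g
  simpa using this

lemma isAllocation_of_exists_mem {A : N → Finset G}
    (hA : (Set.univ : Set N).PairwiseDisjoint A) (h : ∀ g, ∃ a, g ∈ A a) : IsAllocation A :=
  ⟨hA, by ext g; simpa using h g⟩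

lemma isAllocation_reroute {Aa Ab : N → Finset G} (ha : IsAllocation Aa)
    (hb : (Set.univ : Set N).PairwiseDisjoint Ab) {P : Finset G}
    (hP : ∀ g ∈ P, ∃ a, g ∈ Ab a) : IsAllocation (reroute Aa Ab P) := by
  refine isAllocation_of_exists_mem (pairwiseDisjoint_reroute ha.1 hb P) fun g => ?_
  by_cases hg : g ∈ P
  · obtain ⟨a, h⟩ := hP g hg
    exact ⟨a, by simp [reroute, hg, h]⟩
  · obtain ⟨a, h⟩ := ha.exists_mem g
    exact ⟨a, by simp [reroute, hg, h]⟩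

end Families

/-- Two factors split off from a finite product. -/
lemma prod_eq_mul_mul_prod_erase {ι M : Type*} [DecidableEq ι] [CommMonoid M] {s : Finset ι}
    {i j : ι} (hi : i ∈ s) (hj : j ∈ s) (hij : i ≠ j) (f : ι → M) :
    ∏ x ∈ s, f x = f i * f j * ∏ x ∈ (s.erase i).erase j, f x := by
  rw [mul_assoc, mul_prod_erase _ f (mem_erase.2 ⟨hij.symm, hj⟩), mul_prod_erase _ f hi]

section Paths

variable [DecidableEq G] {Aa Ab Bset : N → Finset G}

/-- The goods of a balancing path form a unit flow when `Ab` only holds big goods. -/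
lemma isUnitFlow_of_path [DecidableEq N] (ha : (Set.univ : Set N).PairwiseDisjoint Aa)
    (hb : (Set.univ : Set N).PairwiseDisjoint Ab) (hsub : ∀ a, Ab a ⊆ Bset a)
    {k : ℕ} (hk : 1 ≤ k) {ag : Fin (k + 1) → N} {gd : Fin k → G}
    (hinj : Function.Injective gd)
    (hmem : ∀ t : Fin k, gd t ∈ Aa (ag t.castSucc) ∧ gd t ∈ Ab (ag t.succ))
    (hbal : ∀ t : Fin k, 1 ≤ t.val →
      (gd t ∈ Bset (ag t.castSucc) ↔
        gd ⟨t.val - 1, by have := t.isLt; omega⟩ ∈ Bset (ag t.castSucc))) :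
    IsUnitFlow Aa Ab Bset (ag 0) (ag (Fin.last k)) (univ.image gd) (gd ⟨0, by omega⟩) := by
  refine ⟨⟨by simp, (hmem ⟨0, by omega⟩).1⟩, ?_, ?_, ?_⟩
  · intro g hg
    obtain ⟨t, -, rfl⟩ := mem_image.1 hg
    exact ⟨_, (hmem t).2⟩
  · intro a g hg hga hne
    obtain ⟨t, -, rfl⟩ := mem_image.1 hg
    obtain rfl := eq_of_mem_of_pairwiseDisjoint ha hga (hmem t).1
    have ht : 1 ≤ t.val := by
      by_contra h
      exact hne (congrArg gd (Fin.ext (by simp; omega)))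
    rw [hbal t ht]
    have h := hsub _ (hmem ⟨t.val - 1, by have := t.isLt; omega⟩).2
    have he : (⟨t.val - 1, by have := t.isLt; omega⟩ : Fin k).succ = t.castSucc :=
      Fin.ext (by simp; omega)
    rwa [he] at h
  · intro a
    have key : ∀ (A : N → Finset G) (f : Fin k → N),
        (Set.univ : Set N).PairwiseDisjoint A → (∀ t, gd t ∈ A (f t)) →
        (univ.image gd ∩ A a).card = ∑ t, if f t = a then 1 else 0 := by
      intro A f hA hf
      have : univ.image gd ∩ A a = (univ.filter fun t => f t = a).image gd := by
        ext g
        simp only [mem_inter, mem_image, mem_univ, true_and, mem_filter]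
        constructor
        · rintro ⟨⟨t, rfl⟩, h⟩
          exact ⟨t, eq_of_mem_of_pairwiseDisjoint hA (hf t) h, rfl⟩
        · rintro ⟨t, rfl, rfl⟩
          exact ⟨⟨t, rfl⟩, hf t⟩
      rw [this, card_image_of_injective _ hinj, card_filter]
    rw [key Aa (fun t => ag t.castSucc) ha fun t => (hmem t).1,
      key Ab (fun t => ag t.succ) hb fun t => (hmem t).2,
      ← Fin.sum_univ_castSucc (fun t => if ag t = a then 1 else 0),
      Fin.sum_univ_succ (fun t => if ag t = a then 1 else 0), add_comm]

/-- A walk from `i` to `j` of `k` distinct goods, each big for its owner in `Aa`. -/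
def IsBigWalk (Aa Ab Bset : N → Finset G) (i j : N) (k : ℕ) (ag : ℕ → N) (gd : ℕ → G) : Prop :=
  ag 0 = i ∧ ag k = j ∧ Set.InjOn gd (Set.Iio k) ∧
    ∀ t < k, gd t ∈ Aa (ag t) ∧ gd t ∈ Ab (ag (t + 1)) ∧ gd t ∈ Bset (ag t)

/-- Some walk of big goods leads from `i` to `j`. -/
def BigReachable (Aa Ab Bset : N → Finset G) (i j : N) : Prop :=
  ∃ k ag gd, IsBigWalk Aa Ab Bset i j k ag gd

lemma BigReachable.cons (ha : (Set.univ : Set N).PairwiseDisjoint Aa) {i j c : N} {g : G}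
    (h : BigReachable Aa Ab Bset i j) (hga : g ∈ Aa c) (hgb : g ∈ Ab i) (hg : g ∈ Bset c) :
    BigReachable Aa Ab Bset c j := by
  obtain ⟨k, ag, gd, rfl, rfl, hinj, hmem⟩ := h
  by_cases hex : ∃ t < k, gd t = g
  · obtain ⟨t, ht, rfl⟩ := hex
    refine ⟨k - t, fun s => ag (t + s), fun s => gd (t + s), ?_, ?_, ?_, ?_⟩
    · exact eq_of_mem_of_pairwiseDisjoint ha (hmem t ht).1 hga
    · exact congrArg ag (by omega)
    · intro x hx y hy hxy
      simp only [Set.mem_Iio] at hx hy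
      have := hinj (Set.mem_Iio.2 (by omega)) (Set.mem_Iio.2 (by omega)) hxy
      omega
    · intro s hs
      exact hmem (t + s) (by omega)
  · push Not at hex
    refine ⟨k + 1, fun s => Nat.casesOn s c ag, fun s => Nat.casesOn s g gd, rfl, rfl, ?_, ?_⟩
    · rintro (_ | x) hx (_ | y) hy hxy
      · rfl
      · exact absurd hxy.symm (hex y (by simpa using hy))
      · exact absurd hxy (hex x (by simpa using hx))
      · exact congrArg _ (hinj (by simpa using hx) (by simpa using hy) hxy)
    · rintro (_ | t) ht
      · exact ⟨hga, hgb, hg⟩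
      · exact hmem t (by omega)

lemma BigReachable.existsBBPath (hsub : ∀ a, Ab a ⊆ Bset a) {i j : N} (hij : i ≠ j)
    (h : BigReachable Aa Ab Bset i j) : ExistsBBPath Aa Ab Bset i j := by
  obtain ⟨k, ag, gd, rfl, rfl, hinj, hmem⟩ := h
  have hk : 1 ≤ k := by
    by_contra h0
    exact hij (congrArg ag (by omega))
  refine ⟨k, hk, fun t => ag t, fun t => gd t, ?_, rfl, rfl, ?_, ?_, (hmem 0 hk).2.2, ?_⟩
  · intro x y hxy
    exact Fin.ext (hinj x.isLt y.isLt hxy)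
  · intro t
    exact ⟨(hmem t t.isLt).1, (hmem t t.isLt).2.1⟩
  · intro t ht
    have h := (hmem (t - 1) (by omega)).2.1
    rw [Nat.sub_add_cancel ht] at h
    exact iff_of_true (hmem t t.isLt).2.2 (hsub _ h)
  · have h := (hmem (k - 1) (by omega)).2.1
    rw [Nat.sub_add_cancel hk] at h
    exact hsub _ h

lemma BigReachable.existsSBPath (ha : (Set.univ : Set N).PairwiseDisjoint Aa)
    (hsub : ∀ a, Ab a ⊆ Bset a) {i j c : N} {g : G}
    (h : BigReachable Aa Ab Bset i j) (hga : g ∈ Aa c) (hgb : g ∈ Ab i) (hg : g ∉ Bset c) :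
    ExistsSBPath Aa Ab Bset c j := by
  obtain ⟨k, ag, gd, rfl, rfl, hinj, hmem⟩ := h
  have hne : ∀ t < k, gd t ≠ g := by
    rintro t ht rfl
    exact hg (eq_of_mem_of_pairwiseDisjoint ha (hmem t ht).1 hga ▸ (hmem t ht).2.2)
  have hlast : ∀ t, t < k + 1 → (Nat.casesOn t g gd : G) ∈ Ab (ag t) := by
    rintro (_ | t) ht
    · exact hgb
    · exact (hmem t (by omega)).2.1
  refine ⟨k + 1, by omega, fun t => Nat.casesOn t.val c ag, fun t => Nat.casesOn t.val g gd,
    ?_, rfl, rfl, ?_, ?_, hg, hsub _ (hlast k (by omega))⟩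
  · rintro ⟨_ | x, hx⟩ ⟨_ | y, hy⟩ hxy
    · rfl
    · exact absurd hxy.symm (hne y (by omega))
    · exact absurd hxy (hne x (by omega))
    · have := hinj (Set.mem_Iio.2 (by omega)) (Set.mem_Iio.2 (by omega)) hxy
      exact Fin.ext (congrArg Nat.succ this)
  · rintro ⟨_ | t, ht⟩
    · exact ⟨hga, hgb⟩
    · exact ⟨(hmem t (by omega)).1, (hmem t (by omega)).2.1⟩
  · rintro ⟨_ | t, ht⟩ h1
    · simp at h1
    · exact iff_of_true (hmem t (by omega)).2.2 (hsub _ (hlast t (by omega)))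

end Paths

section Flows

variable [DecidableEq N] [DecidableEq G]
  {Bset : N → Finset G} {v : ℚ} {O Ostar : N → Finset G} {i j : N}

/-- Rerouting a flow of big goods moves one unit of value from `i` to `j`. -/
lemma IsUnitFlow.twoVal_reroute_big (hsub : ∀ a, O a ⊆ Bset a) {P : Finset G} {g₀ : G}
    (hP : IsUnitFlow Ostar O Bset i j P g₀) (hbig : ∀ a, P ∩ Ostar a ⊆ Bset a) (a : N) :
    twoVal Bset v a (reroute Ostar O P a) + (if i = a then 1 else 0) =
      twoVal Bset v a (Ostar a) + (if j = a then 1 else 0) := by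
  have h1 := twoVal_reroute (Bset := Bset) (v := v) (a := a) (Aa := Ostar) (Ab := O) P
  rw [twoVal_of_subset (inter_subset_right.trans (hsub a)), twoVal_of_subset (hbig a)] at h1
  have h2 := congrArg (Nat.cast (R := ℚ)) (hP.card_eq a)
  push_cast at h2
  linarith

/-- Rerouting a flow whose first good is small for `i` costs `i` only `v`. -/
lemma IsUnitFlow.twoVal_reroute_small (hA : (Set.univ : Set N).PairwiseDisjoint Ostar)
    (hsub : ∀ a, O a ⊆ Bset a) {P : Finset G} {g₀ : G}
    (hP : IsUnitFlow Ostar O Bset i j P g₀) (hsmall : g₀ ∉ Bset i) (a : N) :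
    twoVal Bset v a (reroute Ostar O P a) + (if i = a then v else 0) =
      twoVal Bset v a (Ostar a) + (if j = a then 1 else 0) := by
  have h1 := twoVal_reroute (Bset := Bset) (v := v) (a := a) (Aa := Ostar) (Ab := O) P
  rw [twoVal_of_subset (inter_subset_right.trans (hsub a))] at h1
  have h2 := congrArg (Nat.cast (R := ℚ)) (hP.card_eq a)
  push_cast at h2
  by_cases hia : i = a
  · subst hia
    have hg : g₀ ∈ P ∩ Ostar i := mem_inter.2 hP.mem_source
    have hrest : (P ∩ Ostar i).erase g₀ ⊆ Bset i := by
      intro g hg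
      simp only [mem_erase, mem_inter] at hg
      exact hP.big i g hg.2.1 hg.2.2 hg.1
    have h3 : twoVal Bset v i (P ∩ Ostar i) = v + ((P ∩ Ostar i).card - 1) := by
      conv_lhs => rw [← insert_erase hg, insert_eq]
      rw [twoVal_union (by simp), twoVal_singleton_of_notMem hsmall, twoVal_of_subset hrest,
        card_erase_of_mem hg, Nat.cast_sub (card_pos.2 ⟨_, hg⟩)]
      simp
    rw [h3] at h1
    simp only [if_true] at h2 ⊢
    linarith
  · have hbig : P ∩ Ostar a ⊆ Bset a := by
      intro g hg
      rw [mem_inter] at hg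
      refine hP.big a g hg.1 hg.2 ?_
      rintro rfl
      exact hia (eq_of_mem_of_pairwiseDisjoint hA hP.mem_source.2 hg.2)
    rw [twoVal_of_subset hbig] at h1
    simp only [hia, if_false] at h2 ⊢
    linarith

end Flows

section Optimality

variable [Fintype N] [Fintype G] [DecidableEq G]
  {Bset : N → Finset G} {v : ℚ} {O Ostar : N → Finset G} {i j : N}

/-- A maximizer of the Nash product with positive values is Pareto optimal. -/
lemma not_pareto_improvement (h : ∀ A, IsAllocation A → nashProd Bset v A ≤ nashProd Bset v Ostar)
    (hpos : ∀ a, 0 < twoVal Bset v a (Ostar a)) {A : N → Finset G} (hA : IsAllocation A)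
    (hle : ∀ a, twoVal Bset v a (Ostar a) ≤ twoVal Bset v a (A a)) :
    ¬ twoVal Bset v j (Ostar j) < twoVal Bset v j (A j) := fun hlt =>
  absurd (h A hA) (not_le.2 (prod_lt_prod (fun a _ => hpos a) (fun a _ => hle a)
    ⟨j, mem_univ j, hlt⟩))

variable [DecidableEq N]

/-- An agent with fewer big goods in `Ostar` than in `O` is reached by a balancing path. -/
lemma exists_path_of_card_lt (hO : IsNonWasteful Bset O) (hA : IsAllocation Ostar)
    (hj : (Ostar j ∩ Bset j).card < (O j ∩ Bset j).card) :
    (∃ i, ExistsSBPath Ostar O Bset i j) ∨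
      ∃ i, (O i ∩ Bset i).card < (Ostar i ∩ Bset i).card ∧ ExistsBBPath Ostar O Bset i j := by
  classical
  by_contra! hcon
  obtain ⟨hSB, hBB⟩ := hcon
  set S : Finset N := univ.filter fun a => BigReachable Ostar O Bset a j with hS
  have hjS : j ∈ S := by
    simp only [hS, mem_filter, mem_univ, true_and]
    obtain ⟨g, -⟩ : (O j ∩ Bset j).Nonempty := card_pos.1 (by omega)
    exact ⟨0, fun _ => j, fun _ => g, rfl, rfl, by simp [Set.InjOn], by simp⟩
  have hle : ∀ a ∈ S, (Ostar a ∩ Bset a).card ≤ (O a ∩ Bset a).card := by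
    intro a haS
    by_cases haj : a = j
    · subst haj
      exact hj.le
    · by_contra! hlt
      exact hBB a hlt ((mem_filter.1 haS).2.existsBBPath hO.2.1 haj)
  have hlt : ∑ a ∈ S, (Ostar a ∩ Bset a).card < ∑ a ∈ S, (O a ∩ Bset a).card :=
    sum_lt_sum hle ⟨j, hjS, hj⟩
  have hdisj : ∀ A : N → Finset G, (Set.univ : Set N).PairwiseDisjoint A →
      (S.biUnion fun a => A a ∩ Bset a).card = ∑ a ∈ S, (A a ∩ Bset a).card := by
    intro A hA
    refine card_biUnion fun a _ b _ hab => ?_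
    exact (hA (Set.mem_univ a) (Set.mem_univ b) hab).mono inter_subset_left inter_subset_left
  rw [← hdisj _ hA.1, ← hdisj _ hO.1] at hlt
  refine absurd (card_le_card ?_) (not_le.2 hlt)
  intro g hg
  simp only [mem_biUnion, mem_inter] at hg ⊢
  obtain ⟨a, haS, hga, -⟩ := hg
  obtain ⟨c, hgc⟩ := hA.exists_mem g
  have hreach := (mem_filter.1 haS).2
  have hbig : g ∈ Bset c := by
    by_contra hsmall
    exact hSB c (hreach.existsSBPath hA.1 hO.2.1 hgc hga hsmall)
  exact ⟨c, mem_filter.2 ⟨mem_univ c, hreach.cons hA.1 hgc hga hbig⟩, hgc, hbig⟩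

/-- If some agent is short of big goods, the maximal Nash product is positive. -/
lemma NashOptimalClosest.twoVal_pos (hv0 : 0 < v) (hO : IsNonWasteful Bset O)
    (h : NashOptimalClosest Bset v O Ostar)
    (hj : (Ostar j ∩ Bset j).card < (O j ∩ Bset j).card) (a : N) :
    0 < twoVal Bset v a (Ostar a) := by
  refine lt_of_le_of_ne (twoVal_nonneg hv0) fun hzero => ?_
  have hnash : nashProd Bset v Ostar = 0 := prod_eq_zero (mem_univ a) hzero.symm
  set A : N → Finset G := fun c => O c ∪ if c = j then univ \ univ.biUnion O else ∅ with hAdef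
  have hA : IsAllocation A := by
    refine isAllocation_of_exists_mem (pairwiseDisjoint_of_eq fun c d g hc hd => ?_) fun g => ?_
    · have := fun hc hd => eq_of_mem_of_pairwiseDisjoint hO.1 (a := c) (b := d) (g := g) hc hd
      simp only [hAdef] at hc hd
      grind
    · by_cases hg : ∃ c, g ∈ O c
      · obtain ⟨c, hc⟩ := hg
        exact ⟨c, mem_union_left _ hc⟩
      · exact ⟨j, mem_union_right _ (by simpa using hg)⟩
  have hA0 : nashProd Bset v A = nashProd Bset v Ostar :=
    le_antisymm (h.2.1 A hA) (hnash ▸ prod_nonneg fun _ _ => twoVal_nonneg hv0)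
  refine absurd (h.2.2 A hA hA0) (not_le.2 (sum_lt_sum (fun c _ => ?_) ⟨j, mem_univ j, ?_⟩))
  · exact card_le_card (by grind)
  · calc (O j ∩ Ostar j).card ≤ (Ostar j ∩ Bset j).card :=
          card_le_card (by have := hO.2.1 j; grind)
      _ < (O j ∩ Bset j).card := hj
      _ ≤ (O j ∩ A j).card := card_le_card (by grind)

/-- An agent reached by an SB-balancing path holds only big goods in `Ostar`. -/
lemma subset_of_small_flow (hv1 : v < 1) (hO : IsNonWasteful Bset O)
    (hA : IsAllocation Ostar)
    (h : ∀ A, IsAllocation A → nashProd Bset v A ≤ nashProd Bset v Ostar)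
    (hpos : ∀ a, 0 < twoVal Bset v a (Ostar a)) {P : Finset G} {g₀ : G}
    (hP : IsUnitFlow Ostar O Bset i j P g₀) (hsmall : g₀ ∉ Bset i) : Ostar j ⊆ Bset j := by
  have hval := hP.twoVal_reroute_small (v := v) hA.1 hO.2.1 hsmall
  have halloc : IsAllocation (reroute Ostar O P) := isAllocation_reroute hA hO.1 hP.mem_target
  by_cases hij : i = j
  · subst hij
    refine absurd ?_ (not_pareto_improvement (j := i) h hpos halloc fun a => ?_)
    · have := hval i
      simp only [if_true] at this
      linarith
    · have := hval a
      split_ifs at this <;> linarith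
  intro g hg
  by_contra hgB
  have hgP : g ∉ P := by
    intro hgP
    refine hgB (hP.big j g hgP hg ?_)
    rintro rfl
    exact hij (eq_of_mem_of_pairwiseDisjoint hA.1 hP.mem_source.2 hg)
  have hgj : g ∈ reroute Ostar O P j := by simp [reroute, hg, hgP]
  set A : N → Finset G := fun a =>
    if a = i then reroute Ostar O P a ∪ {g} else reroute Ostar O P a \ {g} with hAdef
  have hgi : g ∉ reroute Ostar O P i := fun hgi =>
    hij (eq_of_mem_of_pairwiseDisjoint halloc.1 hgi hgj)
  have hA' : IsAllocation A := by
    refine isAllocation_of_exists_mem (pairwiseDisjoint_of_eq fun c d x hc hd => ?_) fun x => ?_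
    · have := fun hc hd => eq_of_mem_of_pairwiseDisjoint halloc.1 (a := c) (b := d) (g := x) hc hd
      simp only [hAdef] at hc hd
      grind
    · by_cases hx : x = g
      · exact ⟨i, by simp [hAdef, hx]⟩
      · obtain ⟨c, hc⟩ := halloc.exists_mem x
        refine ⟨c, ?_⟩
        simp only [hAdef]
        grind
  have hAi : twoVal Bset v i (Ostar i) ≤ twoVal Bset v i (A i) := by
    have h1 := hval i
    have h2 := le_twoVal_singleton (Bset := Bset) (a := i) hv1 g
    simp only [hAdef, if_true, twoVal_union (disjoint_singleton_right.2 hgi)]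
    simp only [if_true, Ne.symm hij, if_false] at h1
    linarith
  have hAj : twoVal Bset v j (Ostar j) < twoVal Bset v j (A j) := by
    have h1 := hval j
    have h2 : twoVal Bset v j (reroute Ostar O P j) = twoVal Bset v j (A j) + v := by
      have h3 := twoVal_union (Bset := Bset) (v := v) (a := j)
        (sdiff_disjoint : Disjoint (reroute Ostar O P j \ {g}) {g})
      rw [sdiff_union_of_subset (singleton_subset_iff.2 hgj),
        twoVal_singleton_of_notMem hgB] at h3
      simpa only [hAdef, Ne.symm hij, if_false] using h3
    simp only [if_true, hij, if_false] at h1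
    linarith
  refine not_pareto_improvement h hpos hA' (fun a => ?_) hAj
  by_cases hai : a = i
  · exact hai ▸ hAi
  by_cases haj : a = j
  · exact haj ▸ hAj.le
  have h1 := hval a
  have hga : g ∉ reroute Ostar O P a := fun hga =>
    haj (eq_of_mem_of_pairwiseDisjoint halloc.1 hga hgj)
  simp only [Ne.symm hai, Ne.symm haj, if_false, add_zero] at h1
  simp only [hAdef, hai, if_false, sdiff_singleton_eq_erase, erase_eq_of_notMem hga]
  exact h1.ge

/-- Along a flow of big goods from `i` to `j`, the closest Nash optimum gives `i` less than one
unit of value more than `j`. -/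
lemma NashOptimalClosest.twoVal_lt_of_big_flow (hO : IsNonWasteful Bset O)
    (h : NashOptimalClosest Bset v O Ostar) (hpos : ∀ a, 0 < twoVal Bset v a (Ostar a))
    (hij : i ≠ j) {P : Finset G} {g₀ : G} (hP : IsUnitFlow Ostar O Bset i j P g₀)
    (hbig : ∀ a, P ∩ Ostar a ⊆ Bset a) :
    twoVal Bset v i (Ostar i) < twoVal Bset v j (Ostar j) + 1 := by
  have hval := hP.twoVal_reroute_big (v := v) hO.2.1 hbig
  have halloc : IsAllocation (reroute Ostar O P) := isAllocation_reroute h.1 hO.1 hP.mem_target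
  have hsubset : ∀ a, O a ∩ Ostar a ⊆ O a ∩ reroute Ostar O P a := by
    intro a g hg
    grind [reroute]
  have hcloser : ∑ a, (O a ∩ Ostar a).card < ∑ a, (O a ∩ reroute Ostar O P a).card := by
    have hcard := hP.card_eq i
    simp only [if_true, Ne.symm hij, if_false] at hcard
    obtain ⟨g, hg, hgO⟩ := exists_mem_notMem_of_card_lt_card
      (show (P ∩ O i).card < (P ∩ Ostar i).card by omega)
    rw [mem_inter] at hg
    obtain ⟨c, hc⟩ := hP.mem_target g hg.1
    refine sum_lt_sum (fun a _ => card_le_card (hsubset a)) ⟨c, mem_univ c, card_lt_card ?_⟩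
    refine (ssubset_iff_of_subset (hsubset c)).2 ⟨g, ?_, fun hgc => hgO ?_⟩
    · simp [reroute, hc, hg.1]
    · rw [eq_of_mem_of_pairwiseDisjoint h.1.1 hg.2 (mem_inter.1 hgc).2]
      exact mem_inter.2 ⟨hg.1, hc⟩
  have hlt : nashProd Bset v (reroute Ostar O P) < nashProd Bset v Ostar :=
    lt_of_le_of_ne (h.2.1 _ halloc) fun heq => absurd (h.2.2 _ halloc heq) (not_le.2 hcloser)
  unfold nashProd at hlt
  rw [prod_eq_mul_mul_prod_erase (mem_univ i) (mem_univ j) hij,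
    prod_eq_mul_mul_prod_erase (mem_univ i) (mem_univ j) hij] at hlt
  have hrest : ∏ a ∈ (univ.erase i).erase j, twoVal Bset v a (reroute Ostar O P a) =
      ∏ a ∈ (univ.erase i).erase j, twoVal Bset v a (Ostar a) := by
    refine prod_congr rfl fun a ha => ?_
    have := hval a
    simp only [mem_erase] at ha
    simpa [Ne.symm ha.1, Ne.symm ha.2.1] using this
  rw [hrest] at hlt
  have hlt' := lt_of_mul_lt_mul_right hlt (prod_nonneg fun a _ => (hpos a).le)
  have hi := hval i
  have hj := hval j
  simp only [if_true, hij, Ne.symm hij, if_false, add_zero] at hi hj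
  rw [hj, eq_sub_of_add_eq hi] at hlt'
  linarith

/-- Along a flow of big goods from `i` to `j`, a dichotomous optimum gives `j` at most one good
more than `i`. -/
lemma DichOptimal.card_le_of_big_flow (hO : DichOptimal Bset O)
    (hA : IsAllocation Ostar) (hij : i ≠ j) {P : Finset G} {g₀ : G} (hP : IsUnitFlow Ostar O Bset i j P g₀)
    (hbig : ∀ a, P ∩ Ostar a ⊆ Bset a) : (O j).card ≤ (O i).card + 1 := by
  by_contra! hlt
  have hcard : ∀ a, (reroute O Ostar P a).card + (if j = a then 1 else 0) =
      (O a).card + (if i = a then 1 else 0) := by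
    intro a
    have h1 := card_reroute (Aa := O) (Ab := Ostar) (a := a) P
    have h2 := hP.card_eq a
    omega
  have hci := hcard i
  have hcj := hcard j
  simp only [if_true, hij, Ne.symm hij, if_false, add_zero] at hci hcj
  have hcother : ∀ a, a ≠ i → a ≠ j → (reroute O Ostar P a).card = (O a).card := by
    intro a hi hj
    simpa [Ne.symm hi, Ne.symm hj] using hcard a
  have hnw : IsNonWasteful Bset (reroute O Ostar P) := by
    have hsub : ∀ a, reroute O Ostar P a ⊆ Bset a := fun a =>
      union_subset (sdiff_subset.trans (hO.1.2.1 a)) (hbig a)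
    refine ⟨pairwiseDisjoint_reroute hO.1.1 hA.1 P, hsub, Subset.antisymm ?_ ?_⟩
    · exact biUnion_mono fun a _ => hsub a
    · intro g hg
      obtain ⟨b, -, hb⟩ := mem_biUnion.1 hg
      by_cases hgP : g ∈ P
      · obtain ⟨a, ha⟩ := hA.exists_mem g
        exact mem_biUnion.2 ⟨a, mem_univ a, by simp [reroute, hgP, ha]⟩
      · obtain ⟨a, ha⟩ := hO.1.exists_mem hb
        exact mem_biUnion.2 ⟨a, mem_univ a, by simp [reroute, hgP, ha]⟩
  obtain ⟨hmany, hprod⟩ := hO.2 _ hnw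
  have hne : ∀ a, a ≠ i → (reroute O Ostar P a ≠ ∅ ↔ O a ≠ ∅) := by
    intro a hai
    rw [← nonempty_iff_ne_empty, ← nonempty_iff_ne_empty, ← card_pos, ← card_pos]
    by_cases haj : a = j
    · subst haj
      omega
    · rw [hcother a hai haj]
  have hnei : reroute O Ostar P i ≠ ∅ := by
    rw [← nonempty_iff_ne_empty, ← card_pos]
    omega
  by_cases hOi : O i = ∅
  · refine absurd hmany (not_le.2 (card_lt_card ?_))
    refine (ssubset_iff_of_subset fun a ha => ?_).2 ⟨i, by simpa using hnei, by simpa using hOi⟩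
    have hai : a ≠ i := by
      rintro rfl
      simp [hOi] at ha
    simpa [hne a hai] using ha
  have hfilter : (univ.filter fun a => reroute O Ostar P a ≠ ∅) =
      univ.filter fun a => O a ≠ ∅ := by
    refine filter_congr fun a _ => ?_
    by_cases hai : a = i
    · subst hai
      exact iff_of_true hnei hOi
    · exact hne a hai
  have hle := hprod (by rw [hfilter])
  rw [hfilter] at hle
  have hi : i ∈ univ.filter fun a => O a ≠ ∅ := by simpa using hOi
  have hj : j ∈ univ.filter fun a => O a ≠ ∅ := by
    rw [mem_filter, ← nonempty_iff_ne_empty, ← card_pos]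
    exact ⟨mem_univ j, by omega⟩
  rw [prod_eq_mul_mul_prod_erase hi hj hij, prod_eq_mul_mul_prod_erase hi hj hij] at hle
  have hrest : ∏ a ∈ ((univ.filter fun a => O a ≠ ∅).erase i).erase j,
      (reroute O Ostar P a).card =
      ∏ a ∈ ((univ.filter fun a => O a ≠ ∅).erase i).erase j, (O a).card := by
    refine prod_congr rfl fun a ha => ?_
    simp only [mem_erase] at ha
    exact hcother a ha.2.1 ha.1
  rw [hrest] at hle
  have hle' := le_of_mul_le_mul_right hle (prod_pos fun a ha => by
    simp only [mem_erase, mem_filter] at ha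
    exact card_pos.2 (nonempty_iff_ne_empty.2 ha.2.2.2))
  rw [hci] at hle'
  nlinarith

end Optimality

/-- Lemma 4.1: for every agent `j` with `b*_j < b_j`, exactly one of the following
holds: (1) some agent `i` has an SB-balancing path to `j` in `G_{O* → O}`;
(2) some agent `i` with `b*_i > b_i` has a BB-balancing path to `j` in `G_{O* → O}`. -/
theorem stmt5 [Fintype N] [DecidableEq N] [Fintype G] [DecidableEq G]
    (Bset : N → Finset G) (v : ℚ) (hv0 : 0 < v) (hv1 : v < 1)
    (O Ostar : N → Finset G)
    (hO : DichOptimal Bset O) (hOstar : NashOptimalClosest Bset v O Ostar)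
    (j : N) (hj : (Ostar j ∩ Bset j).card < (O j ∩ Bset j).card) :
    ((∃ i : N, ExistsSBPath Ostar O Bset i j) ∨
      (∃ i : N, (O i ∩ Bset i).card < (Ostar i ∩ Bset i).card ∧
        ExistsBBPath Ostar O Bset i j)) ∧
    ¬((∃ i : N, ExistsSBPath Ostar O Bset i j) ∧
      (∃ i : N, (O i ∩ Bset i).card < (Ostar i ∩ Bset i).card ∧
        ExistsBBPath Ostar O Bset i j)) := by
  have hBsub : ∀ a, O a ∩ Bset a = O a := fun a => inter_eq_left.2 (hO.1.2.1 a)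
  refine ⟨exists_path_of_card_lt hO.1 hOstar.1 hj, ?_⟩
  rintro ⟨⟨i, k, hk, ag, gd, hinj, rfl, rfl, hmem, hbal, hsmall, -⟩,
    i', hi', l, hl, ag', gd', hinj', rfl, hlast, hmem', hbal', hfirst, -⟩
  have hpos := hOstar.twoVal_pos hv0 hO.1 hj
  have hSB := isUnitFlow_of_path hOstar.1.1 hO.1.1 hO.1.2.1 hk hinj hmem hbal
  have hBB := isUnitFlow_of_path hOstar.1.1 hO.1.1 hO.1.2.1 hl hinj' hmem' hbal'
  rw [hlast] at hBB
  set j := ag (Fin.last k)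
  set i := ag' 0
  have hij : i ≠ j := by
    intro h
    rw [h] at hi'
    omega
  have hbig : ∀ a, univ.image gd' ∩ Ostar a ⊆ Bset a := by
    intro a g hg
    rw [mem_inter] at hg
    by_cases hg0 : g = gd' ⟨0, by omega⟩
    · rw [hg0] at hg ⊢
      exact eq_of_mem_of_pairwiseDisjoint hOstar.1.1 hBB.mem_source.2 hg.2 ▸ hfirst
    · exact hBB.big a g hg.1 hg.2 hg0
  have hjbig := subset_of_small_flow hv1 hO.1 hOstar.1 hOstar.2.1 hpos hSB hsmall
  have hnash := hOstar.twoVal_lt_of_big_flow hO.1 hpos hij hBB hbig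
  have hdich := hO.card_le_of_big_flow hOstar.1 hij hBB hbig
  rw [hBsub] at hj hi'
  have hcard : (Ostar j ∩ Bset j).card + 1 ≤ (Ostar i ∩ Bset i).card := by omega
  rw [inter_eq_left.2 hjbig] at hcard
  rw [twoVal_of_subset hjbig, twoVal] at hnash
  have hcard' : ((Ostar j).card : ℚ) + 1 ≤ (Ostar i ∩ Bset i).card := by exact_mod_cast hcard
  have hnonneg : 0 ≤ v * ((Ostar i \ Bset i).card : ℚ) := by positivity
  linarith
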